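/- Let d(n,k,p) = #{π ∈ D_n : des_k^D(π) = p} and d̄(n,k,p) = #{π ∈ B_n \ D_n : des_k^B(π) = p}. If n is even with 1 ≤ k ≤ n, or n is odd with 2 ≤ k ≤ n, then d(n,k,p) = d(n,k,n-k+1-p) and d̄(n,k,p) = d̄(n,k,n-k+1-p) for all 0 ≤ p ≤ n-k+1. If n is odd and k = 1, then d(n,1,p) = d̄(n,1,n-p) and d̄(n,1,p) = d(n,1,n-p). -/

import Mathlib

open Finset

/-- The value function of the signed permutation determined by `σ` and sign vector `ε`:
`bval n σ ε i` is `π(i)` for `i ∈ {-n,…,n}`, with `π(0) = 0` and `π(-i) = -π(i)`. -/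
def bval (n : ℕ) (σ : Equiv.Perm (Fin n)) (ε : Fin n → Bool) : ℤ → ℤ := fun i =>
  if h : 1 ≤ i.natAbs ∧ i.natAbs ≤ n then
    (Int.sign i) *
      (if ε ⟨i.natAbs - 1, by omega⟩ then -((((σ ⟨i.natAbs - 1, by omega⟩ : Fin n) : ℕ) : ℤ) + 1)
       else (((σ ⟨i.natAbs - 1, by omega⟩ : Fin n) : ℕ) : ℤ) + 1)
  else 0

/-- width-`k` type-B descent number: `#{0 ≤ i ≤ n-k : π(i) > π(i+k)}`, `π(0)=0`. -/
def desB (n k : ℕ) (π : ℤ → ℤ) : ℕ :=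
  ((range (n - k + 1)).filter fun i : ℕ => π i > π ((i : ℤ) + k)).card

/-- width-`k` type-A descent number: `#{1 ≤ i ≤ n-k : π(i) > π(i+k)}`. -/
def desA (n k : ℕ) (π : ℤ → ℤ) : ℕ :=
  ((Icc 1 (n - k)).filter fun i : ℕ => π i > π ((i : ℤ) + k)).card

/-- width-`k` negative descent number: `#{1 ≤ i ≤ n-k : π(-i) > π(i+k)}`. -/
def ndesB (n k : ℕ) (π : ℤ → ℤ) : ℕ :=
  ((Icc 1 (n - k)).filter fun i : ℕ => π (-(i : ℤ)) > π ((i : ℤ) + k)).card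

/-- width-`k` inversion number: pairs `i < j` in `[n]` with `j - i` a positive multiple of `k`
and `π(i) > π(j)`. -/
def invAk (n k : ℕ) (π : ℤ → ℤ) : ℕ :=
  (((Icc 1 n) ×ˢ (Icc 1 n)).filter fun p : ℕ × ℕ =>
    p.1 < p.2 ∧ k ∣ (p.2 - p.1) ∧ π p.1 > π p.2).card

/-- width-`k` negative-entry statistic: `#{1 ≤ i ≤ ⌊n/k⌋ : π(ik) < 0}`. -/
def negk (n k : ℕ) (π : ℤ → ℤ) : ℕ :=
  ((Icc 1 (n / k)).filter fun i : ℕ => π ((i : ℤ) * k) < 0).card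

/-- width-`k` negative-sum-pair statistic. -/
def nspk (n k : ℕ) (π : ℤ → ℤ) : ℕ :=
  (((Icc 1 n) ×ˢ (Icc 1 n)).filter fun p : ℕ × ℕ =>
    p.1 < p.2 ∧ k ∣ (p.2 - p.1) ∧ π p.1 + π p.2 < 0).card

/-- width-`k` type-B inversion number. -/
def invBk (n k : ℕ) (π : ℤ → ℤ) : ℕ := invAk n k π + negk n k π + nspk n k π

/-- `d(n,k,p) = #{π ∈ D_n : des_k^D(π) = p}` (even number of negative entries). -/
def dcnt (n k p : ℕ) : ℕ :=
  (Finset.univ.filter fun se : Equiv.Perm (Fin n) × (Fin n → Bool) =>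
    Even (Finset.univ.filter fun i => se.2 i = true).card ∧
      desB n k (bval n se.1 se.2) = p).card

/-- `d̄(n,k,p) = #{π ∈ B_n \ D_n : des_k^B(π) = p}` (odd number of negative entries). -/
def dbarcnt (n k p : ℕ) : ℕ :=
  (Finset.univ.filter fun se : Equiv.Perm (Fin n) × (Fin n → Bool) =>
    ¬ Even (Finset.univ.filter fun i => se.2 i = true).card ∧
      desB n k (bval n se.1 se.2) = p).card

theorem card_invol {α : Type*} [Fintype α] (f : α → α) (hf : Function.Involutive f)
    (P Q : α → Prop) [DecidablePred P] [DecidablePred Q] (h : ∀ x, P x ↔ Q (f x)) :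
    (univ.filter P).card = (univ.filter Q).card := by
  refine Finset.card_bij' (fun x _ => f x) (fun x _ => f x) ?_ ?_ ?_ ?_
  · intro x hx
    simp only [mem_filter, mem_univ, true_and] at hx ⊢
    exact (h x).1 hx
  · intro x hx
    simp only [mem_filter, mem_univ, true_and] at hx ⊢
    rw [h, hf x]; exact hx
  · intro x _; exact hf x
  · intro x _; exact hf x

theorem bval_zero (n : ℕ) (σ : Equiv.Perm (Fin n)) (ε : Fin n → Bool) : bval n σ ε 0 = 0 := by
  simp [bval]

theorem bval_succ (n : ℕ) (σ : Equiv.Perm (Fin n)) (ε : Fin n → Bool) (j : Fin n) (z : ℤ)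
    (hz : z = (j : ℕ) + 1) :
    bval n σ ε z = if ε j then -(((σ j : ℕ) : ℤ) + 1) else ((σ j : ℕ) : ℤ) + 1 := by
  have h1 : z.natAbs = (j : ℕ) + 1 := by omega
  have h2 : Int.sign z = 1 := Int.sign_eq_one_of_pos (by omega)
  have h3 := j.2
  have h4 : 1 ≤ z.natAbs ∧ z.natAbs ≤ n := by omega
  have h5 : (⟨z.natAbs - 1, by omega⟩ : Fin n) = j := Fin.ext (by simp; omega)
  unfold bval
  rw [dif_pos h4, h2, h5, one_mul]

theorem desB_neg (n k : ℕ) (hk : 1 ≤ k) (hkn : k ≤ n) (σ : Equiv.Perm (Fin n))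
    (ε : Fin n → Bool) :
    desB n k (bval n σ ε) + desB n k (bval n σ (fun i => !ε i)) = n - k + 1 := by
  have key : ∀ i ∈ range (n - k + 1),
      (bval n σ (fun i => !ε i) (i : ℕ) > bval n σ (fun i => !ε i) ((i : ℤ) + k) ↔
        ¬ (bval n σ ε (i : ℕ) > bval n σ ε ((i : ℤ) + k))) := by
    intro i hi
    rw [mem_range] at hi
    have e2 := fun ε => bval_succ n σ ε ⟨i + k - 1, by omega⟩ ((i : ℤ) + k) (by simp; omega)
    rcases Nat.eq_zero_or_pos i with h0 | h0
    · subst h0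
      rw [e2, e2]
      simp only [Nat.cast_zero, bval_zero]
      cases ε ⟨0 + k - 1, by omega⟩ <;> simp <;> omega
    · have e1 := fun ε => bval_succ n σ ε ⟨i - 1, by omega⟩ (i : ℤ) (by simp; omega)
      rw [e2, e2, e1, e1]
      have hne : (σ ⟨i - 1, by omega⟩ : ℕ) ≠ (σ ⟨i + k - 1, by omega⟩ : ℕ) := by
        intro h
        have := congrArg Fin.val (σ.injective (Fin.ext h))
        simp at this
        omega
      cases ε ⟨i + k - 1, by omega⟩ <;> cases ε ⟨i - 1, by omega⟩ <;> simp <;> omega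
  unfold desB
  rw [Finset.filter_congr key, Finset.card_filter_add_card_filter_not, card_range]

/-- flip the sign at one position -/
def flipAt {n : ℕ} (j : Fin n) (ε : Fin n → Bool) : Fin n → Bool :=
  Function.update ε j (!ε j)

theorem flipAt_flipAt {n : ℕ} (j : Fin n) (ε : Fin n → Bool) : flipAt j (flipAt j ε) = ε := by
  simp [flipAt]

theorem exists_pos (n k : ℕ) (hk : 2 ≤ k) (hkn : k ≤ n) (σ : Equiv.Perm (Fin n)) :
    ∃ j : Fin n, ¬ k ∣ (j : ℕ) + 1 ∧ ∀ l : Fin n, ¬ k ∣ (l : ℕ) + 1 → σ j ≤ σ l := by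
  obtain ⟨j, hj, hm⟩ := Finset.exists_min_image
    (univ.filter fun j : Fin n => ¬ k ∣ (j : ℕ) + 1) (fun j => σ j)
    ⟨⟨0, by omega⟩, by
      simp only [mem_filter, mem_univ, true_and]
      intro h
      have := Nat.le_of_dvd (by omega) h
      omega⟩
  simp only [mem_filter, mem_univ, true_and] at hj hm
  exact ⟨j, hj, hm⟩

theorem desB_flip (n k : ℕ) (hk : 2 ≤ k) (hkn : k ≤ n) (σ : Equiv.Perm (Fin n))
    (ε : Fin n → Bool) (j : Fin n) (hj : ¬ k ∣ (j : ℕ) + 1)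
    (hm : ∀ l : Fin n, ¬ k ∣ (l : ℕ) + 1 → σ j ≤ σ l) :
    desB n k (bval n σ (flipAt j ε)) = desB n k (bval n σ ε) := by
  unfold desB
  congr 1
  apply Finset.filter_congr
  intro i hi
  rw [mem_range] at hi
  have e2 := fun ε => bval_succ n σ ε ⟨i + k - 1, by omega⟩ ((i : ℤ) + k) (by simp; omega)
  have hlt : ∀ l : Fin n, ¬ k ∣ (l : ℕ) + 1 → l ≠ j → (σ j : ℕ) < σ l := by
    intro l hl hlj
    have := hm l hl
    have h2 : σ j ≠ σ l := fun h => hlj (σ.injective h).symm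
    exact Fin.lt_def.1 (lt_of_le_of_ne this h2)
  rcases Nat.eq_zero_or_pos i with h0 | h0
  · subst h0
    have hne : (⟨0 + k - 1, by omega⟩ : Fin n) ≠ j := by
      intro h
      apply hj
      rw [← h]
      simp only
      rw [show 0 + k - 1 + 1 = k by omega]
    rw [e2, e2]
    simp only [Nat.cast_zero, bval_zero, flipAt, Function.update_of_ne hne]
  · have e1 := fun ε => bval_succ n σ ε ⟨i - 1, by omega⟩ (i : ℤ) (by simp; omega)
    rw [e2, e2, e1, e1]
    generalize ha : (⟨i - 1, by omega⟩ : Fin n) = a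
    generalize hb : (⟨i + k - 1, by omega⟩ : Fin n) = b
    have ha' : (a : ℕ) + 1 = i := by rw [← ha]; simp; omega
    have hb' : (b : ℕ) + 1 = i + k := by rw [← hb]; simp; omega
    have hab : a ≠ b := by intro h; rw [h] at ha'; omega
    by_cases h1 : a = j
    · subst h1
      have := hlt b (by rw [hb', Nat.dvd_add_self_right, ← ha']; exact hj) hab.symm
      simp only [flipAt, Function.update_of_ne hab.symm, Function.update_self]
      cases ε a <;> cases ε b <;> simp <;> omega
    · by_cases h2 : b = j
      · subst h2
        have := hlt a (by rw [ha', ← Nat.dvd_add_self_right, ← hb']; exact hj) hab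
        simp only [flipAt, Function.update_of_ne hab, Function.update_self]
        cases ε a <;> cases ε b <;> simp <;> omega
      · simp only [flipAt, Function.update_of_ne h1, Function.update_of_ne h2]

theorem parity_flip {n : ℕ} (j : Fin n) (ε : Fin n → Bool) :
    Even (univ.filter fun i => flipAt j ε i = true).card ↔
      ¬ Even (univ.filter fun i => ε i = true).card := by
  have h : ∀ ε : Fin n → Bool, ε j = false → (univ.filter fun i => flipAt j ε i = true).card =
      (univ.filter fun i => ε i = true).card + 1 := by
    intro ε he
    rw [← Finset.card_insert_of_notMem (a := j) (by simp [he])]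
    congr 1
    ext i
    by_cases hi : i = j
    · subst hi
      simp only [mem_filter, mem_univ, true_and, mem_insert]
      simp [flipAt, he]
    · simp only [mem_filter, mem_univ, true_and, mem_insert]
      simp [flipAt, hi]
  cases he : ε j
  · rw [h ε he, Nat.even_add_one]
  · have := h (flipAt j ε) (by simp [flipAt, he])
    rw [flipAt_flipAt] at this
    rw [this, Nat.even_add_one, not_not]

theorem parity_neg {n : ℕ} (ε : Fin n → Bool) :
    (univ.filter fun i => ε i = true).card + (univ.filter fun i => (!ε i) = true).card = n := by
  have := Finset.card_filter_add_card_filter_not (s := (univ : Finset (Fin n)))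
    (fun i => ε i = true)
  simpa using this

theorem dcnt_eq_dbar (n k p : ℕ) (hk : 2 ≤ k) (hkn : k ≤ n) : dcnt n k p = dbarcnt n k p := by
  choose j hj hm using exists_pos n k hk hkn
  refine card_invol (fun se => (se.1, flipAt (j se.1) se.2)) ?_ _ _ ?_
  · rintro ⟨σ, ε⟩
    simp [flipAt_flipAt]
  · rintro ⟨σ, ε⟩
    simp only [desB_flip n k hk hkn σ ε (j σ) (hj σ) (hm σ), parity_flip, not_not]

theorem invol_neg (n : ℕ) : Function.Involutive
    (fun se : Equiv.Perm (Fin n) × (Fin n → Bool) => (se.1, fun i => !se.2 i)) := by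
  rintro ⟨σ, ε⟩
  simp

theorem even_sym (n k p : ℕ) (hp : p ≤ n - k + 1) (hk : 1 ≤ k) (hkn : k ≤ n) (hn : Even n) :
    dcnt n k p = dcnt n k (n - k + 1 - p) ∧ dbarcnt n k p = dbarcnt n k (n - k + 1 - p) := by
  constructor <;>
  · refine card_invol _ (invol_neg n) _ _ ?_
    rintro ⟨σ, ε⟩
    have h1 := desB_neg n k hk hkn σ ε
    have h2 := parity_neg ε
    simp only [Nat.even_iff] at hn ⊢
    constructor <;> rintro ⟨h3, h4⟩ <;> constructor <;> omega

theorem odd_sym (n k p : ℕ) (hp : p ≤ n - k + 1) (hk : 1 ≤ k) (hkn : k ≤ n) (hn : Odd n) :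
    dcnt n k p = dbarcnt n k (n - k + 1 - p) ∧ dbarcnt n k p = dcnt n k (n - k + 1 - p) := by
  constructor <;>
  · refine card_invol _ (invol_neg n) _ _ ?_
    rintro ⟨σ, ε⟩
    have h1 := desB_neg n k hk hkn σ ε
    have h2 := parity_neg ε
    simp only [Nat.even_iff, Nat.odd_iff] at hn ⊢
    constructor <;> rintro ⟨h3, h4⟩ <;> constructor <;> omega

/-- Proposition 25: symmetries of the type-D / complementary
width-`k` Eulerian distributions under `π ↦ -π`. -/
theorem stmt17 (n k p : ℕ) (hp : p ≤ n - k + 1) :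
    (((Even n ∧ 1 ≤ k ∧ k ≤ n) ∨ (Odd n ∧ 2 ≤ k ∧ k ≤ n)) →
      dcnt n k p = dcnt n k (n - k + 1 - p) ∧
      dbarcnt n k p = dbarcnt n k (n - k + 1 - p)) ∧
    (Odd n → k = 1 →
      dcnt n 1 p = dbarcnt n 1 (n - p) ∧
      dbarcnt n 1 p = dcnt n 1 (n - p)) := by
  constructor
  · rintro (⟨hn, hk, hkn⟩ | ⟨hn, hk, hkn⟩)
    · exact even_sym n k p hp hk hkn hn
    · obtain ⟨h1, h2⟩ := odd_sym n k p hp (by omega) hkn hn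
      rw [← dcnt_eq_dbar n k _ hk hkn] at h1 h2
      rw [← dcnt_eq_dbar n k _ hk hkn, ← dcnt_eq_dbar n k _ hk hkn]
      exact ⟨h1, h1⟩
  · intro hn hk
    subst hk
    have hpos := hn.pos
    have h := odd_sym n 1 p hp le_rfl hpos hn
    rw [Nat.sub_add_cancel hpos] at h
    exact h
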